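/- arXiv:2308.07256 — 2 statements merged into one kernel-verified Lean document; each statement's English description precedes it below -/
import Mathlib

section
/- Let 1 ≤ d ≤ n. Suppose that for each subset P ⊆ {2,…,n} with |P| = d−1 one chooses an ordered set partition π^P ∈ OP(n,d,1) whose underlying unordered set partition is noncrossing and whose set of block minima is {1} ∪ P. Then the family { [π^P]_1 : P ⊆ {2,…,n}, |P| = d−1 } is a ℂ-basis of the hook Specht module S^{(d,1^{n−d})}, realized as the span of products of one top-justified ν×ν minor (ν = n−d+1) and d−1 entries from the first row corresponding to a set partition of the columns. -/
open scoped Classical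

namespace Jellyfish

/-- A tableau with `ν` rows and `d` columns, whose cells are either empty or
contain an element of `Fin n`. -/
abbrev Tab (ν n d : ℕ) := Fin ν → Fin d → Option (Fin n)

/-- `π` is an ordered set partition of `[n]` into `d` blocks, each of size at least `r`:
blocks are pairwise disjoint with union `[n]` and cardinality at least `r`. -/
def IsOSP (n d r : ℕ) (π : Fin d → Finset (Fin n)) : Prop :=
  (∀ j, r ≤ (π j).card) ∧
  (∀ j k, j ≠ k → Disjoint (π j) (π k)) ∧
  (Finset.univ.biUnion π = Finset.univ)

/-- The nonempty entries of column `j` of `T`, read from top to bottom. -/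
def colList {ν n d : ℕ} (T : Tab ν n d) (j : Fin d) : List (Fin n) :=
  (List.finRange ν).filterMap (fun i => T i j)

/-- `T` is an `r`-jellyfish tableau for `π`: it has `n - (d-1)r` rows and `d` columns,
every cell in the first `r` rows is nonempty, every lower row has exactly one nonempty
cell, and the nonempty entries of column `j`, top to bottom, are exactly the elements
of `π j` in increasing order. -/
def IsJelly (n d r : ℕ) (π : Fin d → Finset (Fin n)) (T : Tab (n - (d-1)*r) n d) : Prop :=
  (∀ i : Fin (n - (d-1)*r), (i : ℕ) < r → ∀ j, (T i j).isSome) ∧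
  (∀ i : Fin (n - (d-1)*r), r ≤ (i : ℕ) → ∃! j, (T i j).isSome) ∧
  (∀ j, colList T j = (π j).sort (· ≤ ·))

/-- The row reading word of `T` (rows top to bottom, each row left to right), with
each entry tagged by its column index. -/
def cells {ν n d : ℕ} (T : Tab ν n d) : List (Fin d × Fin n) :=
  (List.finRange ν).flatMap (fun i =>
    (List.finRange d).filterMap (fun j => (T i j).map (fun v => (j, v))))

/-- The number of inversions of a (column-tagged) word: pairs of positions `p < q`
whose values are inverted. -/
def invList {n d : ℕ} : List (Fin d × Fin n) → ℕ
  | [] => 0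
  | a :: l => l.countP (fun b => decide (b.2 < a.2)) + invList l

/-- The number of inversions of a (column-tagged) word that do not involve two
entries lying in the same column. -/
def invList' {n d : ℕ} : List (Fin d × Fin n) → ℕ
  | [] => 0
  | a :: l => l.countP (fun b => decide (b.2 < a.2 ∧ b.1 ≠ a.1)) + invList' l

/-- The sign `(-1)^(inv T)` of a tableau, where `inv T` counts all inversions of the
row reading word. -/
def tabSign {ν n d : ℕ} (T : Tab ν n d) : ℤ := (-1) ^ invList (cells T)

/-- The sign `(-1)^(inv T)` of a (column-permuted) tableau, where inversions within a
single column are not counted. -/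
def tabSign' {ν n d : ℕ} (T : Tab ν n d) : ℤ := (-1) ^ invList' (cells T)

/-- The minor `M_I^J` of the `ν × n` matrix of indeterminates `x_{ij}`: the determinant
of the submatrix with rows `I` and columns `J`, each taken in increasing order
(and `0` if `|I| ≠ |J|`). -/
noncomputable def minor (ν n : ℕ) (I : Finset (Fin ν)) (J : Finset (Fin n)) :
    MvPolynomial (Fin ν × Fin n) ℂ :=
  if h : I.card = J.card then
    Matrix.det (Matrix.of fun a b : Fin I.card =>
      MvPolynomial.X (I.orderEmbOfFin rfl a, J.orderEmbOfFin h.symm b))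
  else 0

/-- The set `R_j(T)` of rows of `T` containing an entry of block `j`. -/
def rowsUsed {ν n d : ℕ} (T : Tab ν n d) (j : Fin d) : Finset (Fin ν) :=
  Finset.univ.filter (fun i => (T i j).isSome)

/-- The product of minors `J(T) = ∏_j M_{R_j(T)}^{π_j}`. -/
noncomputable def JProd {ν n d : ℕ} (π : Fin d → Finset (Fin n)) (T : Tab ν n d) :
    MvPolynomial (Fin ν × Fin n) ℂ :=
  ∏ j : Fin d, minor ν n (rowsUsed T j) (π j)

/-- The `r`-jellyfish invariant `[π]_r = Σ_{T ∈ J_r(π)} sgn(T)·J(T)`. -/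
noncomputable def jellyInv (n d r : ℕ) (π : Fin d → Finset (Fin n)) :
    MvPolynomial (Fin (n - (d-1)*r) × Fin n) ℂ :=
  ∑ T : Tab (n - (d-1)*r) n d,
    if IsJelly n d r π T then (tabSign T : ℂ) • JProd π T else 0


/-- Permute the columns of `T` according to `σ`: column `j` of the result is
column `σ⁻¹ j` of `T`. -/
def colPerm {ν n d : ℕ} (σ : Equiv.Perm (Fin d)) (T : Tab ν n d) : Tab ν n d :=
  fun i j => T i (σ⁻¹ j)

/-- The top `k` rows of a tableau with `ν` rows. -/
def topRows (ν k : ℕ) : Finset (Fin ν) := Finset.univ.filter (fun i => (i : ℕ) < k)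

/-- The top-justified minor `p_J`, using rows `1, …, |J|` and the columns in `J`
(in increasing order). -/
noncomputable def topMinor (ν n : ℕ) (J : Finset (Fin n)) :
    MvPolynomial (Fin ν × Fin n) ℂ :=
  minor ν n (topRows ν J.card) J

/-- The spanning set of the flamingo Specht module `S^{(d^r, 1^{n-rd})}`: all products
`∏_i p_{J_i}` over tuples `(J_1, …, J_d)` of pairwise disjoint subsets of `[n]` with
union `[n]`, `|J_1| = n-(d-1)r` and `|J_i| = r` for `i ≥ 2`. -/
def flamingoSet (n d r : ℕ) : Set (MvPolynomial (Fin (n - (d-1)*r) × Fin n) ℂ) :=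
  { f | ∃ Js : Fin d → Finset (Fin n),
      (∀ i j, i ≠ j → Disjoint (Js i) (Js j)) ∧
      (Finset.univ.biUnion Js = Finset.univ) ∧
      (∀ i : Fin d, (i : ℕ) = 0 → (Js i).card = n - (d-1)*r) ∧
      (∀ i : Fin d, (i : ℕ) ≠ 0 → (Js i).card = r) ∧
      f = ∏ i : Fin d, topMinor (n - (d-1)*r) n (Js i) }

/-- `P` is an (unordered) set partition of `[n]`: a collection of pairwise disjoint
nonempty blocks whose union is `[n]`. -/
def IsUPartition (n : ℕ) (P : Finset (Finset (Fin n))) : Prop :=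
  (∀ B ∈ P, B.Nonempty) ∧
  (∀ B1 ∈ P, ∀ B2 ∈ P, B1 ≠ B2 → Disjoint B1 B2) ∧
  (∀ x : Fin n, ∃ B ∈ P, x ∈ B)

/-- `P` is noncrossing: there do not exist `a < b < c < e` with `a, c` in one block
and `b, e` in a different block. -/
def IsNoncrossing (n : ℕ) (P : Finset (Finset (Fin n))) : Prop :=
  ∀ a b c e : Fin n, a < b → b < c → c < e →
    ∀ B1 ∈ P, ∀ B2 ∈ P, a ∈ B1 → c ∈ B1 → b ∈ B2 → e ∈ B2 → B1 = B2

/-- `P` is a noncrossing set partition of `[n]` into `d` blocks, each of size at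
least `r` (the set `NC(n,d,r)`). -/
def IsNCPartition (n d r : ℕ) (P : Finset (Finset (Fin n))) : Prop :=
  IsUPartition n P ∧ IsNoncrossing n P ∧ P.card = d ∧ ∀ B ∈ P, r ≤ B.card

/-- The set of smallest elements of the blocks of an ordered set partition. -/
def blockMinima (n d : ℕ) (π : Fin d → Finset (Fin n)) : Finset (Fin n) :=
  Finset.univ.filter (fun x => ∃ j, x ∈ π j ∧ ∀ y ∈ π j, x ≤ y)

/-- The set of smallest elements (block minima) of an unordered set partition. -/
def blockMinimaU (n : ℕ) (P : Finset (Finset (Fin n))) : Finset (Fin n) :=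
  Finset.univ.filter (fun x => ∃ B ∈ P, x ∈ B ∧ ∀ y ∈ B, x ≤ y)

/-- The set of largest elements (block maxima) of an unordered set partition. -/
def blockMaximaU (n : ℕ) (P : Finset (Finset (Fin n))) : Finset (Fin n) :=
  Finset.univ.filter (fun x => ∃ B ∈ P, x ∈ B ∧ ∀ y ∈ B, y ≤ x)

/-! ### Signs of words -/

theorem neg_one_pow_invList_ofFn {n d N : ℕ} (f : Fin N → Fin d × Fin n) :
    (-1 : ℤ) ^ invList (List.ofFn f) =
      ∏ i, ∏ j, if i < j ∧ (f j).2 < (f i).2 then (-1 : ℤ) else 1 := by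
  induction N with
  | zero => simp [invList]
  | succ N ih =>
    rw [List.ofFn_succ, invList, pow_add, ih, Fin.prod_univ_succ]
    congr 1
    · rw [Fin.prod_univ_succ]
      simp only [lt_irrefl, false_and, if_false, one_mul, Fin.succ_pos, true_and]
      rw [Finset.prod_ite, Finset.prod_const, Finset.prod_const_one, mul_one]
      congr 1
      rw [List.ofFn_eq_map, List.countP_map, List.countP_eq_length_filter,
        ← List.toFinset_card_of_nodup ((List.nodup_finRange N).filter _)]
      congr 1
      ext x
      simp
    · refine Finset.prod_congr rfl fun i _ => ?_
      rw [Fin.prod_univ_succ]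
      simp [Fin.succ_lt_succ_iff]

theorem neg_one_pow_invList_ofFn_perm {n d : ℕ} (γ : Fin n → Fin d) (σ : Equiv.Perm (Fin n)) :
    (-1 : ℤ) ^ invList (List.ofFn fun p => (γ p, σ p)) = Equiv.Perm.sign σ := by
  rw [neg_one_pow_invList_ofFn, Equiv.Perm.sign_eq_prod_prod_Ioi]
  push_cast
  refine Finset.prod_congr rfl fun i _ => ?_
  rw [← Finset.prod_subset (Finset.subset_univ (Finset.Ioi i))]
  · refine Finset.prod_congr rfl fun j hj => ?_
    have hij : i < j := Finset.mem_Ioi.1 hj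
    have hne : σ i ≠ σ j := fun h => hij.ne (σ.injective h)
    rcases lt_or_gt_of_ne hne with h | h
    · simp [h, h.not_gt]
    · simp [h, h.not_gt, hij]
  · intro j _ hj
    simp [Finset.mem_Ioi] at hj
    simp [hj.not_gt]

/-! ### The columns of a tableau -/

theorem eq_of_filterMap_eq {α β : Type*} {f g : α → Option β} :
    ∀ l : List α, (∀ a ∈ l, ((f a).isSome ↔ (g a).isSome)) →
      l.filterMap f = l.filterMap g → ∀ a ∈ l, f a = g a
  | [], _, _ => by simp
  | a :: l, h, h' => by
    have ha := h a (by simp)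
    have ih := eq_of_filterMap_eq (f := f) (g := g) l fun b hb => h b (by simp [hb])
    cases hf : f a with
    | none =>
      cases hg : g a with
      | none =>
        rw [List.filterMap_cons_none hf, List.filterMap_cons_none hg] at h'
        simpa [hf, hg] using ih h'
      | some w => simp [hf, hg] at ha
    | some v =>
      cases hg : g a with
      | none => simp [hf, hg] at ha
      | some w =>
        rw [List.filterMap_cons_some hf, List.filterMap_cons_some hg, List.cons.injEq] at h'
        simpa [hf, hg, h'.1] using ih h'.2

theorem colList_eq_sort_iff {ν n d : ℕ} (T : Tab ν n d) (j : Fin d) (s : Finset (Fin n)) :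
    colList T j = s.sort (· ≤ ·) ↔
      (∀ i i', i < i' → ∀ v, T i j = some v → ∀ v', T i' j = some v' → v < v') ∧
        ∀ v, v ∈ s ↔ ∃ i, T i j = some v := by
  have hlt : (colList T j).SortedLT ↔
      ∀ i i', i < i' → ∀ v, T i j = some v → ∀ v', T i' j = some v' → v < v' := by
    rw [List.sortedLT_iff_pairwise, colList, List.pairwise_filterMap, ← List.ofFn_id,
      List.pairwise_ofFn]
    rfl
  have hmem : ∀ v, v ∈ colList T j ↔ ∃ i, T i j = some v := by simp [colList]
  rw [← hlt]
  constructor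
  · intro h
    exact ⟨h ▸ s.sortedLT_sort, fun v => by rw [← hmem, h, Finset.mem_sort]⟩
  · rintro ⟨h1, h2⟩
    exact h1.eq_of_mem_iff s.sortedLT_sort fun v => by rw [hmem, Finset.mem_sort, h2]

/-! ### The shape of a `1`-jellyfish tableau -/

/-- `1`-jellyfish tableaux, with the number of rows left free. -/
def IsOneJelly {ν n d : ℕ} (π : Fin d → Finset (Fin n)) (T : Tab ν n d) : Prop :=
  (∀ i : Fin ν, (i : ℕ) < 1 → ∀ j, (T i j).isSome) ∧
  (∀ i : Fin ν, 1 ≤ (i : ℕ) → ∃! j, (T i j).isSome) ∧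
  (∀ j, colList T j = (π j).sort (· ≤ ·))

/-- The `1`-jellyfish invariant, with the number of rows left free. -/
noncomputable def oneJellyInv (ν n d : ℕ) (π : Fin d → Finset (Fin n)) :
    MvPolynomial (Fin ν × Fin n) ℂ :=
  ∑ T : Tab ν n d, if IsOneJelly π T then (tabSign T : ℂ) • JProd π T else 0

/-- The row of a cell of a jellyfish tableau, where `inl j` stands for the cell of column `j`
in the top row and `inr k` for the only cell of the row `k + 1`. -/
def cellRow {d m : ℕ} : Fin d ⊕ Fin m → Fin (m + 1) := Sum.elim (fun _ => 0) Fin.succ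

/-- The column of a cell of a jellyfish tableau whose lower cells are placed by `g`. -/
def cellCol {d m : ℕ} (g : Fin m → Fin d) : Fin d ⊕ Fin m → Fin d := Sum.elim id g

/-- The nonempty cells of `T` are the top row and the cells of the lower rows given by `g`. -/
def HasShape {n d m : ℕ} (T : Tab (m + 1) n d) (g : Fin m → Fin d) : Prop :=
  ∀ i j, (T i j).isSome ↔ ∃ r, cellRow r = i ∧ cellCol g r = j

theorem cell_ext {d m : ℕ} {g : Fin m → Fin d} {r r' : Fin d ⊕ Fin m}
    (h : cellRow r = cellRow r') (h' : cellCol g r = cellCol g r') : r = r' := by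
  rcases r with j | k <;> rcases r' with j' | k' <;>
    simp_all [cellRow, cellCol, Fin.succ_ne_zero, (Fin.succ_ne_zero _).symm]

theorem filterMap_ite_eq {α β : Type*} [DecidableEq α] (a : α) (b : β) (l : List α) :
    l.filterMap (fun x => if a = x then some b else none) = List.replicate (l.count a) b := by
  induction l with
  | nil => rfl
  | cons x l ih =>
    by_cases h : a = x
    · subst h
      simp [ih, List.replicate_succ]
    · simp [ih, h, Ne.symm h]

section Shape

variable {n d m : ℕ} {T : Tab (m + 1) n d} {g : Fin m → Fin d}

theorem HasShape.zero (h : HasShape T g) (j : Fin d) : (T 0 j).isSome :=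
  (h 0 j).2 ⟨Sum.inl j, rfl, rfl⟩

theorem HasShape.succ (h : HasShape T g) (k : Fin m) (j : Fin d) :
    (T k.succ j).isSome ↔ g k = j := by
  rw [h]
  constructor
  · rintro ⟨j' | k', hr, hc⟩
    · exact absurd hr.symm (Fin.succ_ne_zero k)
    · rw [← Fin.succ_injective _ hr]
      exact hc
  · intro hj
    exact ⟨Sum.inr k, rfl, hj⟩

theorem hasShape_iff : HasShape T g ↔
    (∀ j, (T 0 j).isSome) ∧ ∀ k j, ((T k.succ j).isSome ↔ g k = j) := by
  refine ⟨fun h => ⟨h.zero, h.succ⟩, fun ⟨h0, h1⟩ i j => ?_⟩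
  refine Fin.cases ?_ (fun k => ?_) i
  · exact iff_of_true (h0 j) ⟨Sum.inl j, rfl, rfl⟩
  · rw [h1]
    constructor
    · intro hj
      exact ⟨Sum.inr k, rfl, hj⟩
    · rintro ⟨j' | k', hr, hc⟩
      · exact absurd hr.symm (Fin.succ_ne_zero k)
      · rw [← Fin.succ_injective _ hr]
        exact hc

theorem HasShape.unique {g' : Fin m → Fin d} (h : HasShape T g) (h' : HasShape T g') :
    g = g' := by
  funext k
  exact (h.succ k _).1 ((h'.succ k _).2 rfl)

theorem isOneJelly_iff (π : Fin d → Finset (Fin n)) :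
    IsOneJelly π T ↔
      (∃ g, HasShape T g) ∧ ∀ j, colList T j = (π j).sort (· ≤ ·) := by
  constructor
  · rintro ⟨h0, h1, h2⟩
    have h1' : ∀ k : Fin m, ∃! j, (T k.succ j).isSome := fun k => h1 k.succ (by simp)
    choose g hg hu using h1'
    refine ⟨⟨g, hasShape_iff.2 ⟨h0 0 (by simp), fun k j => ⟨fun h => (hu k j h).symm, ?_⟩⟩⟩, h2⟩
    rintro rfl
    exact hg k
  · rintro ⟨⟨g, hg⟩, h2⟩
    refine ⟨fun i hi => ?_, fun i => ?_, h2⟩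
    · have : i = 0 := Fin.ext (by simpa using hi)
      exact this ▸ hg.zero
    · refine Fin.cases (fun h => absurd h (by simp)) (fun k _ => ?_) i
      exact ⟨g k, (hg.succ k _).2 rfl, fun j hj => ((hg.succ k j).1 hj).symm⟩

theorem HasShape.isSome (h : HasShape T g) (r : Fin d ⊕ Fin m) :
    (T (cellRow r) (cellCol g r)).isSome :=
  (h _ _).2 ⟨r, rfl, rfl⟩

/-- The entries of a tableau, indexed by its cells. -/
def HasShape.entry (h : HasShape T g) (r : Fin d ⊕ Fin m) : Fin n :=
  (T (cellRow r) (cellCol g r)).get (h.isSome r)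

theorem HasShape.eq_some_entry (h : HasShape T g) (r : Fin d ⊕ Fin m) :
    T (cellRow r) (cellCol g r) = some (h.entry r) := by
  simp [HasShape.entry]

theorem HasShape.cells_eq (h : HasShape T g) :
    cells T = List.ofFn fun p : Fin (d + m) =>
      (cellCol g (finSumFinEquiv.symm p), h.entry (finSumFinEquiv.symm p)) := by
  have hsplit : (fun p : Fin (d + m) =>
      (cellCol g (finSumFinEquiv.symm p), h.entry (finSumFinEquiv.symm p))) =
      Fin.append (fun j => (j, h.entry (Sum.inl j))) fun k => (g k, h.entry (Sum.inr k)) := by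
    funext p
    refine Fin.addCases (fun j => ?_) (fun k => ?_) p
    · simp [cellCol]
    · simp [cellCol]
  rw [hsplit, List.ofFn_fin_append, cells, List.finRange_succ, List.flatMap_cons,
    List.flatMap_map]
  congr 1
  · rw [List.ofFn_eq_map, ← List.filterMap_eq_map]
    refine List.filterMap_congr fun j _ => ?_
    have := h.eq_some_entry (Sum.inl j)
    simp only [cellRow, cellCol, Sum.elim_inl, id] at this
    simp [this]
  · rw [List.ofFn_eq_map, List.map_eq_flatMap]
    refine List.flatMap_congr fun k _ => ?_
    have hk := h.eq_some_entry (Sum.inr k)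
    simp only [cellRow, cellCol, Sum.elim_inr] at hk
    have hfun : (fun j => (T k.succ j).map fun v => (j, v)) =
        fun j => if g k = j then some (g k, h.entry (Sum.inr k)) else none := by
      funext j
      split_ifs with hj
      · subst hj
        simp [hk]
      · have := (h.succ k j).not.2 hj
        simp at this
        simp [this]
    rw [hfun, filterMap_ite_eq, List.count_eq_one_of_mem (List.nodup_finRange d) (List.mem_finRange _)]
    rfl

end Shape

/-! ### Jellyfish tableaux and block determinants -/

theorem IsOSP.eq_of_mem {n d r : ℕ} {π : Fin d → Finset (Fin n)} (hπ : IsOSP n d r π)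
    {j k : Fin d} {c : Fin n} (hj : c ∈ π j) (hk : c ∈ π k) : j = k := by
  by_contra h
  exact Finset.disjoint_left.1 (hπ.2.1 j k h) hj hk

theorem IsOSP.exists_mem {n d r : ℕ} {π : Fin d → Finset (Fin n)} (hπ : IsOSP n d r π)
    (c : Fin n) : ∃ j, c ∈ π j := by
  have : c ∈ Finset.univ.biUnion π := hπ.2.2 ▸ Finset.mem_univ c
  simpa using this

theorem det_eq_sign_mul_det {ι κ R : Type*} [Fintype ι] [DecidableEq ι] [Fintype κ]
    [DecidableEq κ] [CommRing R] (A : ι → κ → R) (e τ : ι ≃ κ) :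
    (Matrix.of fun r r' => A r (e r')).det =
      (Equiv.Perm.sign (e.symm.trans τ) : ℤ) * (Matrix.of fun r r' => A r (τ r')).det := by
  have h := Matrix.det_permute' (e.trans τ.symm) (Matrix.of fun r r' => A r (τ r'))
  have hs : Equiv.Perm.sign (e.trans τ.symm) = Equiv.Perm.sign (e.symm.trans τ) := by
    rw [← Equiv.Perm.sign_symm_trans_trans (e.trans τ.symm) e, ← Equiv.Perm.sign_inv]
    congr 1
    ext x
    simp [Equiv.Perm.inv_def]
  rw [← hs, ← h]
  congr 1
  ext r r'
  simp

/-- The row vector attached to a cell: the row of the generic matrix through the cell,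
restricted to the block of the column of the cell. -/
noncomputable def cellForm {n d m : ℕ} (π : Fin d → Finset (Fin n)) (g : Fin m → Fin d)
    (r : Fin d ⊕ Fin m) (c : Fin n) : MvPolynomial (Fin (m + 1) × Fin n) ℂ :=
  if c ∈ π (cellCol g r) then MvPolynomial.X (cellRow r, c) else 0

section Jelly

variable {d m : ℕ} {π : Fin d → Finset (Fin (d + m))} {T : Tab (m + 1) (d + m) d}
  {g : Fin m → Fin d}

theorem HasShape.entry_mem (h : HasShape T g) (hc : ∀ j, colList T j = (π j).sort (· ≤ ·))
    (r : Fin d ⊕ Fin m) : h.entry r ∈ π (cellCol g r) :=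
  (((colList_eq_sort_iff T _ _).1 (hc _)).2 _).2 ⟨_, h.eq_some_entry r⟩

theorem HasShape.entry_lt (h : HasShape T g) (hc : ∀ j, colList T j = (π j).sort (· ≤ ·))
    {r r' : Fin d ⊕ Fin m} (hcol : cellCol g r = cellCol g r') (hrow : cellRow r < cellRow r') :
    h.entry r < h.entry r' :=
  ((colList_eq_sort_iff T _ _).1 (hc (cellCol g r))).1 _ _ hrow _ (h.eq_some_entry r) _
    (hcol ▸ h.eq_some_entry r')

theorem HasShape.entry_bijective (h : HasShape T g)
    (hc : ∀ j, colList T j = (π j).sort (· ≤ ·)) (hπ : IsOSP (d + m) d 1 π) :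
    Function.Bijective h.entry := by
  refine (Fintype.bijective_iff_injective_and_card _).2 ⟨fun r r' hr => ?_, by simp⟩
  have hcol : cellCol g r = cellCol g r' :=
    hπ.eq_of_mem (h.entry_mem hc r) (hr ▸ h.entry_mem hc r')
  refine cell_ext (g := g) ?_ hcol
  by_contra hne
  rcases lt_or_gt_of_ne hne with hlt | hlt
  · exact (h.entry_lt hc hcol hlt).ne hr
  · exact (h.entry_lt hc hcol.symm hlt).ne hr.symm

theorem HasShape.mem_rowsUsed (h : HasShape T g) (i : Fin (m + 1)) (j : Fin d) :
    i ∈ rowsUsed T j ↔ ∃ r, cellRow r = i ∧ cellCol g r = j := by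
  simp [rowsUsed, h i j]

theorem HasShape.det_block (h : HasShape T g) (hc : ∀ j, colList T j = (π j).sort (· ≤ ·))
    (hπ : IsOSP (d + m) d 1 π) (j : Fin d) :
    (Matrix.of fun r r' : {r // cellCol g r = j} =>
      cellForm π g r (h.entry r')).det = minor (m + 1) (d + m) (rowsUsed T j) (π j) := by
  have hcell : ∀ a : Fin (rowsUsed T j).card, ∃ r : {r // cellCol g r = j},
      cellRow r.1 = (rowsUsed T j).orderEmbOfFin rfl a := by
    intro a
    obtain ⟨r, hr, hj⟩ := (h.mem_rowsUsed _ j).1 ((rowsUsed T j).orderEmbOfFin_mem rfl a)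
    exact ⟨⟨r, hj⟩, hr⟩
  choose f hf using hcell
  have hfb : Function.Bijective f := by
    refine ⟨fun a b hab => ?_, fun r => ?_⟩
    · apply ((rowsUsed T j).orderEmbOfFin rfl).injective
      rw [← hf, ← hf, hab]
    · have hr : cellRow r.1 ∈ Set.range ((rowsUsed T j).orderEmbOfFin rfl) := by
        rw [Finset.range_orderEmbOfFin]
        exact (h.mem_rowsUsed _ j).2 ⟨r, rfl, r.2⟩
      obtain ⟨a, ha⟩ := hr
      refine ⟨a, Subtype.ext (cell_ext (g := g) ?_ ((f a).2.trans r.2.symm))⟩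
      rw [hf, ha]
  have hmono : StrictMono fun a => h.entry (f a).1 := fun a b hab =>
    h.entry_lt hc ((f a).2.trans (f b).2.symm) (by
      rw [hf, hf]
      exact ((rowsUsed T j).orderEmbOfFin rfl).strictMono hab)
  have hmem : ∀ a, h.entry (f a).1 ∈ π j := fun a => by
    have := h.entry_mem hc (f a).1
    rwa [(f a).2] at this
  have hcard : (rowsUsed T j).card = (π j).card := by
    have himage : Finset.univ.image (fun a => h.entry (f a).1) = π j := by
      ext c
      simp only [Finset.mem_image, Finset.mem_univ, true_and]
      refine ⟨?_, fun hcj => ?_⟩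
      · rintro ⟨a, rfl⟩
        exact hmem a
      · obtain ⟨r, rfl⟩ := (h.entry_bijective hc hπ).2 c
        obtain ⟨a, ha⟩ := hfb.2 ⟨r, hπ.eq_of_mem (h.entry_mem hc r) hcj⟩
        exact ⟨a, by rw [ha]⟩
    rw [← himage, Finset.card_image_of_injective _ hmono.injective, Finset.card_univ,
      Fintype.card_fin]
  have hentry := Finset.orderEmbOfFin_unique hcard.symm hmem hmono
  rw [minor, dif_pos hcard, ← Matrix.det_submatrix_equiv_self (Equiv.ofBijective f hfb)]
  congr 1
  ext1 a b
  have hb : h.entry (f b).1 = (π j).orderEmbOfFin hcard.symm b := congrFun hentry b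
  simp only [Matrix.submatrix_apply, Matrix.of_apply, Equiv.ofBijective_apply, cellForm, hf, hb,
    (f a).2, Finset.orderEmbOfFin_mem, if_true]

theorem HasShape.sign_smul_JProd (h : HasShape T g)
    (hc : ∀ j, colList T j = (π j).sort (· ≤ ·)) (hπ : IsOSP (d + m) d 1 π) :
    (tabSign T : ℂ) • JProd π T =
      (Matrix.of fun r r' => cellForm π g r (finSumFinEquiv r')).det := by
  set τ := Equiv.ofBijective _ (h.entry_bijective hc hπ) with hτ
  have htri : (Matrix.of fun r r' => cellForm π g r (τ r')).BlockTriangular (cellCol g) := by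
    intro r r' hlt
    rw [Matrix.of_apply, cellForm, if_neg]
    intro hmem
    exact hlt.ne (hπ.eq_of_mem (h.entry_mem hc r') hmem)
  rw [det_eq_sign_mul_det (cellForm π g) finSumFinEquiv τ, htri.det_fintype, JProd, tabSign,
    h.cells_eq]
  have hsign := neg_one_pow_invList_ofFn_perm
    (fun p => cellCol g (finSumFinEquiv.symm p)) (finSumFinEquiv.symm.trans τ)
  simp only [Equiv.trans_apply] at hsign
  have hτe : ∀ r, τ r = h.entry r := fun r => rfl
  simp only [hτe] at hsign
  rw [hsign]
  have hprod : ∀ j, (Matrix.toSquareBlock (Matrix.of fun r r' => cellForm π g r (τ r'))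
      (cellCol g) j).det = minor (m + 1) (d + m) (rowsUsed T j) (π j) := fun j =>
    h.det_block hc hπ j
  simp only [hprod]
  rw [MvPolynomial.smul_eq_C_mul]
  simp

end Jelly

/-! ### The jellyfish invariant as a determinant -/

/-- The first row of the generic matrix restricted to the set `S` of columns. -/
noncomputable def topForm {n : ℕ} (m : ℕ) (S : Finset (Fin n)) (c : Fin n) :
    MvPolynomial (Fin (m + 1) × Fin n) ℂ :=
  if c ∈ S then MvPolynomial.X (0, c) else 0

theorem MultilinearMap.map_sumElim_sum {R M N ι κ α : Type*} [CommRing R] [AddCommGroup M]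
    [Module R M] [AddCommGroup N] [Module R N] [Fintype κ] [Fintype α]
    (f : MultilinearMap R (fun _ : ι ⊕ κ => M) N) (u : ι → M) (v : κ → α → M) :
    f (Sum.elim u fun k => ∑ a, v k a) = ∑ g : κ → α, f (Sum.elim u fun k => v k (g k)) :=
  (MultilinearMap.currySum f u).map_sum v

/-- The determinant of a square matrix whose columns are indexed by another type than its
rows, as a multilinear function of the rows. -/
def detForm {κ β : Type*} (R : Type*) [Fintype κ] [DecidableEq κ] [CommRing R] (e : κ ≃ β) :
    MultilinearMap R (fun _ : κ => β → R) R :=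
  (Matrix.detRowAlternating (n := κ) (R := R)).toMultilinearMap.compLinearMap
    fun _ => LinearMap.funLeft R R e

theorem detForm_apply {κ β R : Type*} [Fintype κ] [DecidableEq κ] [CommRing R] (e : κ ≃ β)
    (v : κ → β → R) : detForm R e v = (Matrix.of fun r r' => v r (e r')).det :=
  rfl

theorem det_cellForm_eq_zero {d m : ℕ} {π : Fin d → Finset (Fin (d + m))} {g : Fin m → Fin d}
    (hπ : IsOSP (d + m) d 1 π)
    (hg : ¬ ∃ T : Tab (m + 1) (d + m) d, HasShape T g ∧ IsOneJelly π T) :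
    (Matrix.of fun r r' => cellForm π g r (finSumFinEquiv r')).det = 0 := by
  contrapose! hg
  rw [Matrix.det_apply] at hg
  obtain ⟨σ, -, hσ⟩ := Finset.exists_ne_zero_of_sum_ne_zero hg
  have hmem : ∀ r, finSumFinEquiv r ∈ π (cellCol g (σ r)) := by
    intro r
    by_contra hr
    refine hσ ?_
    rw [Finset.prod_eq_zero (Finset.mem_univ r), smul_zero]
    simp [cellForm, hr]
  set R : Fin d → Finset (Fin (m + 1)) := fun j =>
    (Finset.univ.filter fun r => cellCol g r = j).image cellRow with hR
  have hcard : ∀ j, (π j).card = (R j).card := by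
    intro j
    rw [hR, Finset.card_image_of_injOn]
    · symm
      refine Finset.card_bij (fun r _ => finSumFinEquiv (σ.symm r)) ?_ ?_ ?_
      · intro r hr
        have := hmem (σ.symm r)
        rw [Equiv.apply_symm_apply] at this
        rwa [(Finset.mem_filter.1 hr).2] at this
      · intro r _ r' _ h
        exact σ.symm.injective (finSumFinEquiv.injective h)
      · intro c hcj
        refine ⟨σ (finSumFinEquiv.symm c), ?_, by simp⟩
        have := hmem (finSumFinEquiv.symm c)
        rw [Equiv.apply_symm_apply] at this
        simpa using hπ.eq_of_mem this hcj
    · intro r hr r' hr' h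
      simp only [Finset.coe_filter, Finset.mem_univ, true_and, Set.mem_ofPred_eq] at hr hr'
      exact cell_ext h (hr.trans hr'.symm)
  set T : Tab (m + 1) (d + m) d := fun i j =>
    if h : i ∈ R j then
      some ((π j).orderEmbOfFin (hcard j) (((R j).orderIsoOfFin rfl).symm ⟨i, h⟩)) else none
    with hT
  have hTsome : ∀ i j v, T i j = some v ↔ ∃ h : i ∈ R j,
      (π j).orderEmbOfFin (hcard j) (((R j).orderIsoOfFin rfl).symm ⟨i, h⟩) = v := by
    intro i j v
    by_cases h : i ∈ R j <;> simp [hT, h]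
  have hshape : HasShape T g := by
    intro i j
    have hiR : i ∈ R j ↔ ∃ r, cellRow r = i ∧ cellCol g r = j := by
      simp [hR, and_comm]
    rw [← hiR]
    by_cases h : i ∈ R j <;> simp [hT, h]
  refine ⟨T, hshape, (isOneJelly_iff π).2 ⟨⟨g, hshape⟩, fun j => ?_⟩⟩
  rw [colList_eq_sort_iff]
  constructor
  · intro i i' hlt v hv v' hv'
    obtain ⟨h, rfl⟩ := (hTsome _ _ _).1 hv
    obtain ⟨h', rfl⟩ := (hTsome _ _ _).1 hv'
    simpa using hlt
  · intro v
    simp only [hTsome]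
    constructor
    · intro hv
      have hrange : v ∈ Set.range ((π j).orderEmbOfFin (hcard j)) := by
        rwa [Finset.range_orderEmbOfFin]
      obtain ⟨a, rfl⟩ := hrange
      exact ⟨_, ((R j).orderIsoOfFin rfl a).2,
        congrArg _ (((R j).orderIsoOfFin rfl).symm_apply_apply a)⟩
    · rintro ⟨i, h, rfl⟩
      exact Finset.orderEmbOfFin_mem _ _ _

theorem oneJellyInv_eq_detForm {d m : ℕ} (hd : 0 < d) {π : Fin d → Finset (Fin (d + m))}
    (hπ : IsOSP (d + m) d 1 π) :
    oneJellyInv (m + 1) (d + m) d π =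
      detForm _ finSumFinEquiv (Sum.elim (fun j => topForm m (π j)) fun (k : Fin m) c =>
        MvPolynomial.X (k.succ, c)) := by
  have : Nonempty (Fin d) := ⟨⟨0, hd⟩⟩
  have hrow : (fun (k : Fin m) (c : Fin (d + m)) =>
      (MvPolynomial.X (k.succ, c) : MvPolynomial (Fin (m + 1) × Fin (d + m)) ℂ)) =
      fun k => ∑ j, fun c => if c ∈ π j then MvPolynomial.X (k.succ, c) else 0 := by
    funext k c
    obtain ⟨j, hj⟩ := hπ.exists_mem c
    rw [Finset.sum_apply, Finset.sum_eq_single j, if_pos hj]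
    · intro j' _ hne
      exact if_neg fun h => hne (hπ.eq_of_mem h hj)
    · simp
  have hform : ∀ g : Fin m → Fin d,
      (Sum.elim (fun j => topForm m (π j)) fun k c =>
        if c ∈ π (g k) then MvPolynomial.X (k.succ, c) else 0) = cellForm π g := by
    intro g
    funext r c
    rcases r with j | k <;> rfl
  rw [hrow, MultilinearMap.map_sumElim_sum, oneJellyInv, ← Finset.sum_filter]
  simp only [hform, detForm_apply]
  refine Finset.sum_of_injOn (fun T => Classical.epsilon (HasShape T)) ?_ (by simp) ?_ ?_
  · intro T hT T' hT' h
    simp only [Finset.coe_filter, Finset.mem_univ, true_and, Set.mem_ofPred_eq,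
      isOneJelly_iff] at hT hT' h
    have hs := Classical.epsilon_spec hT.1
    have hs' := Classical.epsilon_spec hT'.1
    rw [← h] at hs'
    funext i j
    exact eq_of_filterMap_eq (f := fun i => T i j) (g := fun i => T' i j) (List.finRange (m + 1))
      (fun i _ => (hs i j).trans (hs' i j).symm) ((hT.2 j).trans (hT'.2 j).symm) i
      (List.mem_finRange i)
  · intro g _ hg
    refine det_cellForm_eq_zero hπ ?_
    rintro ⟨T, hs, hT⟩
    exact hg ⟨T, by simpa using hT, (Classical.epsilon_spec ⟨g, hs⟩).unique hs⟩
  · intro T hT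
    simp only [Finset.mem_filter, Finset.mem_univ, true_and, isOneJelly_iff] at hT
    exact (Classical.epsilon_spec hT.1).sign_smul_JProd hT.2 hπ

/-! ### Linear independence -/

theorem linearIndependent_of_triangular {K M ι : Type*} [Field K] [AddCommGroup M] [Module K M]
    [Fintype ι] (v : ι → M) (L : ι → M →ₗ[K] K) (w : ι → ℕ)
    (hlt : ∀ p q, L q (v p) ≠ 0 → p = q ∨ w p < w q) (hdiag : ∀ p, L p (v p) ≠ 0) :
    LinearIndependent K v := by
  rw [Fintype.linearIndependent_iff]
  intro c hc
  suffices h : ∀ N p, w p < N → c p = 0 from fun p => h _ p (Nat.lt_succ_self _)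
  intro N
  induction N with
  | zero => simp
  | succ N ih =>
    intro p hp
    have h := congrArg (L p) hc
    rw [map_sum, map_zero, Finset.sum_eq_single p] at h
    · rw [map_smul, smul_eq_mul] at h
      exact (mul_eq_zero.1 h).resolve_right (hdiag p)
    · intro q _ hqp
      rw [map_smul, smul_eq_mul]
      by_cases hL : L p (v q) = 0
      · rw [hL, mul_zero]
      · rw [ih q (by have := (hlt q p hL).resolve_left hqp; omega), zero_mul]
    · simp

section Evaluation

variable {d m : ℕ} {π : Fin d → Finset (Fin (d + m))}

theorem exists_blockMin (hπ : IsOSP (d + m) d 1 π) {M : Finset (Fin (d + m))}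
    (hM : blockMinima (d + m) d π = M) :
    ∃ mn : Fin d → Fin (d + m), Function.Injective mn ∧ (∀ j, mn j ∈ π j) ∧
      (∀ j, ∀ y ∈ π j, mn j ≤ y) ∧ Finset.univ.image mn = M := by
  have hne : ∀ j, (π j).Nonempty := fun j => Finset.card_pos.1 (hπ.1 j)
  refine ⟨fun j => (π j).min' (hne j), fun j k h => ?_, fun j => Finset.min'_mem _ _,
    fun j y hy => Finset.min'_le _ _ hy, ?_⟩
  · refine hπ.eq_of_mem (Finset.min'_mem _ (hne j)) ?_
    simp only at h
    rw [h]
    exact Finset.min'_mem _ _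
  · rw [← hM]
    ext x
    simp only [Finset.mem_image, Finset.mem_univ, true_and, blockMinima, Finset.mem_filter]
    refine exists_congr fun j => ⟨?_, fun ⟨hx, hy⟩ => ?_⟩
    · rintro rfl
      exact ⟨Finset.min'_mem _ _, fun y hy => Finset.min'_le _ _ hy⟩
    · exact le_antisymm (Finset.min'_le _ _ hx) (Finset.le_min' _ _ _ hy)

/-- The 0-1 matrix whose top row is the indicator of `M` and whose lower rows are the unit
vectors at the positions `ρ k`. -/
noncomputable def testPoint {n : ℕ} (M : Finset (Fin n)) (ρ : Fin m → Fin n) :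
    Fin (m + 1) × Fin n → ℂ :=
  fun x => Fin.cases (if x.2 ∈ M then 1 else 0) (fun k => if x.2 = ρ k then 1 else 0) x.1

/-- The rows of the jellyfish determinant at a test point. -/
noncomputable def testRow {n : ℕ} (π : Fin d → Finset (Fin n)) (M : Finset (Fin n))
    (ρ : Fin m → Fin n) : Fin d ⊕ Fin m → Fin n → ℂ :=
  Sum.elim (fun j c => if c ∈ π j ∧ c ∈ M then 1 else 0) fun k c => if c = ρ k then 1 else 0

theorem eval_oneJellyInv (hd : 0 < d) (hπ : IsOSP (d + m) d 1 π) (M : Finset (Fin (d + m)))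
    (ρ : Fin m → Fin (d + m)) :
    MvPolynomial.eval (testPoint M ρ) (oneJellyInv (m + 1) (d + m) d π) =
      (Matrix.of fun r r' => testRow π M ρ r (finSumFinEquiv r')).det := by
  rw [oneJellyInv_eq_detForm hd hπ, detForm_apply, RingHom.map_det]
  congr 1
  ext r r'
  rcases r with j | k
  · simp only [RingHom.mapMatrix_apply, Matrix.map_apply, Matrix.of_apply, Sum.elim_inl, testRow,
      topForm, apply_ite (MvPolynomial.eval (testPoint M ρ)), MvPolynomial.eval_X, map_zero,
      ite_and]
    rfl
  · simp [testRow, testPoint]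

theorem eval_blockMin_ne_zero (hd : 0 < d) (hπ : IsOSP (d + m) d 1 π) {M : Finset (Fin (d + m))}
    (hM : blockMinima (d + m) d π = M) {ρ : Fin m → Fin (d + m)} (hρ : Function.Injective ρ)
    (hρM : ∀ k, ρ k ∉ M) :
    MvPolynomial.eval (testPoint M ρ) (oneJellyInv (m + 1) (d + m) d π) ≠ 0 := by
  obtain ⟨mn, hinj, hmem, -, himage⟩ := exists_blockMin hπ hM
  have hmnM : ∀ j, mn j ∈ M := fun j => himage ▸ Finset.mem_image_of_mem _ (Finset.mem_univ j)
  have hbij : Function.Bijective (Sum.elim mn ρ) := by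
    refine (Fintype.bijective_iff_injective_and_card _).2 ⟨?_, by simp⟩
    exact hinj.sumElim hρ fun j k h => hρM k (h ▸ hmnM j)
  rw [eval_oneJellyInv hd hπ,
    det_eq_sign_mul_det _ finSumFinEquiv (Equiv.ofBijective _ hbij)]
  have hone : (Matrix.of fun r r' =>
      testRow π M ρ r (Equiv.ofBijective _ hbij r')) = 1 := by
    ext r r'
    rcases r with j | k <;> rcases r' with j' | k'
    · have : mn j' ∈ π j ↔ j = j' :=
        ⟨fun h => hπ.eq_of_mem h (hmem j'), fun h => h ▸ hmem j⟩
      simp [testRow, hmnM, this, Matrix.one_apply]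
    · simp [testRow, hρM]
    · have : mn j' ≠ ρ k := fun h => hρM k (h ▸ hmnM j')
      simp [testRow, this]
    · simp [testRow, Matrix.one_apply, hρ.eq_iff, eq_comm]
  rw [hone, Matrix.det_one, mul_one]
  exact_mod_cast (Equiv.Perm.sign _).ne_zero

theorem eq_or_sum_lt_of_eval_ne_zero (hd : 0 < d) (hπ : IsOSP (d + m) d 1 π)
    {M M' : Finset (Fin (d + m))} (hM : blockMinima (d + m) d π = M) (hM' : M'.card = d)
    {ρ : Fin m → Fin (d + m)}
    (h : MvPolynomial.eval (testPoint M' ρ) (oneJellyInv (m + 1) (d + m) d π) ≠ 0) :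
    M = M' ∨ ∑ x ∈ M, (x : ℕ) < ∑ x ∈ M', (x : ℕ) := by
  obtain ⟨mn, hinj, hmem, hmin, himage⟩ := exists_blockMin hπ hM
  rw [eval_oneJellyInv hd hπ, Matrix.det_apply] at h
  obtain ⟨σ, -, hσ⟩ := Finset.exists_ne_zero_of_sum_ne_zero h
  have hf : ∀ j, finSumFinEquiv (σ.symm (Sum.inl j)) ∈ π j ∧
      finSumFinEquiv (σ.symm (Sum.inl j)) ∈ M' := by
    intro j
    by_contra hj
    refine hσ ?_
    rw [Finset.prod_eq_zero (Finset.mem_univ (σ.symm (Sum.inl j))), smul_zero]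
    rw [Matrix.of_apply, Equiv.apply_symm_apply, testRow, Sum.elim_inl, if_neg hj]
  set f : Fin d → Fin (d + m) := fun j => finSumFinEquiv (σ.symm (Sum.inl j)) with hfdef
  have hfinj : Function.Injective f :=
    finSumFinEquiv.injective.comp (σ.symm.injective.comp Sum.inl_injective)
  have hfimage : Finset.univ.image f = M' := by
    refine Finset.eq_of_subset_of_card_le ?_ ?_
    · intro x hx
      obtain ⟨j, -, rfl⟩ := Finset.mem_image.1 hx
      exact (hf j).2
    · rw [Finset.card_image_of_injective _ hfinj, hM']
      simp
  have hle : ∀ j ∈ Finset.univ, (mn j : ℕ) ≤ f j := fun j _ => hmin j _ (hf j).1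
  rw [← himage, ← hfimage, Finset.sum_image hinj.injOn, Finset.sum_image hfinj.injOn]
  rcases (Finset.sum_le_sum hle).eq_or_lt with heq | hlt
  · left
    congr 1
    funext j
    exact Fin.ext ((Finset.sum_eq_sum_iff_of_le hle).1 heq j (Finset.mem_univ j))
  · exact Or.inr hlt

end Evaluation

/-! ### The hook Specht module -/

/-- The spanning set of the hook Specht module, with the number of rows left free. -/
def hookSet (ν n d : ℕ) : Set (MvPolynomial (Fin ν × Fin n) ℂ) :=
  { f | ∃ Js : Fin d → Finset (Fin n),
      (∀ i j, i ≠ j → Disjoint (Js i) (Js j)) ∧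
      (Finset.univ.biUnion Js = Finset.univ) ∧
      (∀ i : Fin d, (i : ℕ) = 0 → (Js i).card = ν) ∧
      (∀ i : Fin d, (i : ℕ) ≠ 0 → (Js i).card = 1) ∧
      f = ∏ i : Fin d, topMinor ν n (Js i) }

theorem minor_eq_det {ν n k : ℕ} {I : Finset (Fin ν)} {J : Finset (Fin n)} (hI : I.card = k)
    (hJ : J.card = k) :
    minor ν n I J = (Matrix.of fun a b : Fin k =>
      (MvPolynomial.X (I.orderEmbOfFin hI a, J.orderEmbOfFin hJ b) :
        MvPolynomial (Fin ν × Fin n) ℂ)).det := by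
  subst hI
  rw [minor, dif_pos hJ.symm]

theorem topMinor_singleton {m n : ℕ} (c : Fin n) :
    topMinor (m + 1) n {c} = MvPolynomial.X (0, c) := by
  have htop : topRows (m + 1) ({c} : Finset (Fin n)).card = {0} := by
    ext i
    simp only [topRows, Finset.card_singleton, Finset.mem_filter, Finset.mem_univ, true_and,
      Finset.mem_singleton, Fin.ext_iff, Fin.val_zero, Nat.lt_one_iff]
  rw [topMinor, htop, minor_eq_det (Finset.card_singleton _) (Finset.card_singleton _)]
  simp

theorem topMinor_eq_det {m n : ℕ} {J : Finset (Fin n)} (hJ : J.card = m + 1) :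
    topMinor (m + 1) n J = (Matrix.of fun a b : Fin (m + 1) =>
      (MvPolynomial.X (a, J.orderEmbOfFin hJ b) :
        MvPolynomial (Fin (m + 1) × Fin n) ℂ)).det := by
  have htop : topRows (m + 1) J.card = Finset.univ := by
    ext i
    simp only [topRows, hJ, Finset.mem_filter, Finset.mem_univ, true_and, i.is_lt]
  rw [topMinor, htop, minor_eq_det (by simp) hJ]
  have hid := Finset.orderEmbOfFin_unique (s := (Finset.univ : Finset (Fin (m + 1))))
    (k := m + 1) (f := id) (by simp) (by simp) strictMono_id
  rw [← hid]
  rfl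

/-- The rows of the generic matrix. -/
noncomputable def genRow (n m : ℕ) (k : Fin (m + 1)) (c : Fin n) :
    MvPolynomial (Fin (m + 1) × Fin n) ℂ :=
  MvPolynomial.X (k, c)

theorem topForm_eq_sum {n : ℕ} (m : ℕ) (S : Finset (Fin n)) :
    topForm m S = ∑ c ∈ S, topForm m {c} := by
  funext x
  simp [topForm, Finset.sum_apply]

theorem genRow_zero_eq_sum (n m : ℕ) : genRow n m 0 = ∑ c, topForm m {c} := by
  rw [← topForm_eq_sum]
  funext c
  simp [genRow, topForm]

theorem detForm_eq_zero {κ β R : Type*} [Fintype κ] [DecidableEq κ] [CommRing R] (e : κ ≃ β)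
    {v : κ → β → R} {r r' : κ} (hv : v r = v r') (hne : r ≠ r') : detForm R e v = 0 := by
  rw [detForm_apply]
  exact Matrix.det_zero_of_row_eq hne (by ext c; simp [hv])

section Hook

variable {n d m : ℕ} (e : Fin d ⊕ Fin (m + 1) ≃ Fin n)

/-- The determinant whose rows are the entries of the first row in the columns `c i`, followed by
all rows of the generic matrix. -/
noncomputable def hookForm (c : Fin d → Fin n) : MvPolynomial (Fin (m + 1) × Fin n) ℂ :=
  detForm _ e (Sum.elim (fun i => topForm m {c i}) (genRow n m))

theorem hookForm_eq_zero {c : Fin d → Fin n} (hc : ¬ Function.Injective c) :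
    hookForm e c = 0 := by
  simp only [Function.Injective, not_forall] at hc
  obtain ⟨i, j, hij, hne⟩ := hc
  exact detForm_eq_zero e (r := Sum.inl i) (r' := Sum.inl j) (by simp [hij]) (by simpa using hne)

theorem card_compl_image {c : Fin d → Fin n} (hc : Function.Injective c)
    (hn : n = d + (m + 1)) : (Finset.univ.image c)ᶜ.card = m + 1 := by
  rw [Finset.card_compl, Finset.card_image_of_injective _ hc]
  simp
  omega

theorem card_eq_of_equiv (e : Fin d ⊕ Fin (m + 1) ≃ Fin n) : n = d + (m + 1) := by
  simpa using (Fintype.card_congr e).symm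

theorem hookForm_eq_smul {c : Fin d → Fin n} (hc : Function.Injective c) :
    ∃ s : ℤˣ, hookForm e c = (s : ℤ) •
      ((∏ x ∈ Finset.univ.image c, MvPolynomial.X (0, x)) *
        topMinor (m + 1) n (Finset.univ.image c)ᶜ) := by
  have hcard := card_compl_image hc (card_eq_of_equiv e)
  set J := (Finset.univ.image c)ᶜ with hJ
  have hdisj : ∀ i k, c i ≠ J.orderEmbOfFin hcard k := by
    intro i k h
    have hk := J.orderEmbOfFin_mem hcard k
    rw [← h, hJ, Finset.mem_compl] at hk
    exact hk (Finset.mem_image_of_mem _ (Finset.mem_univ i))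
  have hbij : Function.Bijective (Sum.elim c (J.orderEmbOfFin hcard)) := by
    refine (Fintype.bijective_iff_injective_and_card _).2 ⟨?_, Fintype.card_congr e⟩
    exact hc.sumElim (J.orderEmbOfFin hcard).injective hdisj
  refine ⟨Equiv.Perm.sign (e.symm.trans (Equiv.ofBijective _ hbij)), ?_⟩
  rw [hookForm, detForm_apply, det_eq_sign_mul_det _ e (Equiv.ofBijective _ hbij), zsmul_eq_mul]
  congr 1
  have hblock : (Matrix.of fun r r' => (Sum.elim (fun i => topForm m {c i}) (genRow n m) :
        Fin d ⊕ Fin (m + 1) → Fin n → MvPolynomial (Fin (m + 1) × Fin n) ℂ) r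
        (Equiv.ofBijective _ hbij r')) =
      Matrix.fromBlocks (Matrix.diagonal fun i => MvPolynomial.X (0, c i)) 0
        (Matrix.of fun k i => MvPolynomial.X (k, c i))
        (Matrix.of fun k l => MvPolynomial.X (k, J.orderEmbOfFin hcard l)) := by
    ext1 r r'
    rcases r with i | k <;> rcases r' with i' | k'
    · by_cases h : i = i'
      · subst h
        simp [topForm]
      · simp [topForm, h, hc.eq_iff, Ne.symm h]
    · simp [topForm, (hdisj _ _).symm]
    · simp [genRow]
    · simp [genRow]
  rw [hblock, Matrix.det_fromBlocks_zero₁₂, Matrix.det_diagonal, topMinor_eq_det hcard,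
    Finset.prod_image hc.injOn]

theorem mem_hookSet_iff (hn : n = d + (m + 1)) (f : MvPolynomial (Fin (m + 1) × Fin n) ℂ) :
    f ∈ hookSet (m + 1) n (d + 1) ↔ ∃ c : Fin d → Fin n, Function.Injective c ∧
      f = (∏ x ∈ Finset.univ.image c, MvPolynomial.X (0, x)) *
        topMinor (m + 1) n (Finset.univ.image c)ᶜ := by
  constructor
  · rintro ⟨Js, hdisj, hunion, -, h1, rfl⟩
    have hsing : ∀ i : Fin d, ∃ x, Js i.succ = {x} := fun i =>
      Finset.card_eq_one.1 (h1 i.succ (by simp))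
    choose c hc using hsing
    have hinj : Function.Injective c := by
      intro i j hij
      by_contra hne
      have := hdisj i.succ j.succ (by simpa using hne)
      simp [hc, hij] at this
    have h0 : Js 0 = (Finset.univ.image c)ᶜ := by
      ext x
      simp only [Finset.mem_compl, Finset.mem_image, Finset.mem_univ, true_and, not_exists]
      constructor
      · rintro hx i rfl
        exact Finset.disjoint_left.1 (hdisj 0 i.succ (Fin.succ_ne_zero i).symm) hx (by simp [hc])
      · intro hx
        have hxu : x ∈ Finset.univ.biUnion Js := hunion ▸ Finset.mem_univ x
        obtain ⟨i, -, hi⟩ := Finset.mem_biUnion.1 hxu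
        revert hi
        refine Fin.cases id (fun i hi => ?_) i
        rw [hc, Finset.mem_singleton] at hi
        exact absurd hi.symm (hx i)
    refine ⟨c, hinj, ?_⟩
    rw [Fin.prod_univ_succ, h0, mul_comm, Finset.prod_image hinj.injOn]
    simp only [hc, topMinor_singleton]
  · rintro ⟨c, hc, rfl⟩
    refine ⟨Fin.cons (Finset.univ.image c)ᶜ fun i => {c i}, ?_, ?_, ?_, ?_, ?_⟩
    · intro i j
      refine Fin.cases ?_ (fun i => ?_) i <;> refine Fin.cases ?_ (fun j => ?_) j
      · simp
      · simp
      · simp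
      · simpa using fun h => Ne.symm (hc.ne (Ne.symm h))
    · ext x
      simp only [Finset.mem_biUnion, Finset.mem_univ, true_and, iff_true, Fin.exists_fin_succ,
        Fin.cons_zero, Fin.cons_succ, Finset.mem_compl, Finset.mem_image, Finset.mem_singleton]
      rw [or_comm]
      simp only [eq_comm (a := x)]
      exact em _
    · intro i hi
      have : i = 0 := Fin.ext hi
      subst this
      exact card_compl_image hc hn
    · intro i
      refine Fin.cases (by simp) (fun i _ => by simp) i
    · rw [Fin.prod_univ_succ, mul_comm, Finset.prod_image hc.injOn]
      simp [topMinor_singleton]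

theorem span_hookSet :
    Submodule.span ℂ (hookSet (m + 1) n (d + 1)) = Submodule.span ℂ (Set.range (hookForm e)) := by
  apply le_antisymm <;> rw [Submodule.span_le]
  · intro f hf
    obtain ⟨c, hc, rfl⟩ := (mem_hookSet_iff (card_eq_of_equiv e) f).1 hf
    obtain ⟨s, hs⟩ := hookForm_eq_smul e hc
    have : (∏ x ∈ Finset.univ.image c, MvPolynomial.X (0, x)) *
        topMinor (m + 1) n (Finset.univ.image c)ᶜ = ((s⁻¹ : ℤˣ) : ℤ) • hookForm e c := by
      rw [hs, smul_smul, ← Units.val_mul, inv_mul_cancel, Units.val_one, one_smul]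
    rw [SetLike.mem_coe, this]
    exact zsmul_mem (Submodule.subset_span (Set.mem_range_self c)) _
  · rintro _ ⟨c, rfl⟩
    by_cases hc : Function.Injective c
    · obtain ⟨s, hs⟩ := hookForm_eq_smul e hc
      rw [SetLike.mem_coe, hs]
      exact zsmul_mem (Submodule.subset_span
        ((mem_hookSet_iff (card_eq_of_equiv e) _).2 ⟨c, hc, rfl⟩)) _
    · rw [hookForm_eq_zero e hc]
      exact zero_mem _

theorem sum_hookForm_update (c : Fin d → Fin n) (i : Fin d) :
    ∑ x, hookForm e (Function.update c i x) = 0 := by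
  have hupd : ∀ x, hookForm e (Function.update c i x) = detForm _ e (Function.update
      (Sum.elim (fun i => topForm m {c i}) (genRow n m)) (Sum.inl i) (topForm m {x})) := by
    intro x
    rw [hookForm]
    congr 1
    funext r
    rcases r with j | k
    · by_cases h : j = i
      · subst h
        simp
      · simp [h]
    · simp
  simp only [hupd]
  rw [← MultilinearMap.map_update_sum, ← genRow_zero_eq_sum]
  exact detForm_eq_zero e (r := Sum.inl i) (r' := Sum.inr 0) (by simp) (by simp)

theorem span_hookForm_le (z : Fin n) :
    Submodule.span ℂ (Set.range (hookForm e)) ≤ Submodule.span ℂ (Set.range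
      fun P : {P : Finset (Fin n) // z ∉ P ∧ P.card = d} =>
        hookForm e (P.1.orderEmbOfFin P.2.2)) := by
  set W := Submodule.span ℂ (Set.range
      fun P : {P : Finset (Fin n) // z ∉ P ∧ P.card = d} =>
        hookForm e (P.1.orderEmbOfFin P.2.2)) with hW
  have havoid : ∀ c : Fin d → Fin n, (∀ i, c i ≠ z) → hookForm e c ∈ W := by
    intro c hcz
    by_cases hc : Function.Injective c
    · have hP : z ∉ Finset.univ.image c ∧ (Finset.univ.image c).card = d := by
        refine ⟨by simpa using hcz, ?_⟩
        rw [Finset.card_image_of_injective _ hc]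
        simp
      obtain ⟨s, hs⟩ := hookForm_eq_smul e hc
      obtain ⟨t, ht⟩ := hookForm_eq_smul e
        ((Finset.univ.image c).orderEmbOfFin hP.2).injective
      have himage : Finset.univ.image ((Finset.univ.image c).orderEmbOfFin hP.2) =
          Finset.univ.image c := by
        apply Finset.coe_injective
        rw [Finset.coe_image, Finset.coe_univ, Set.image_univ, Finset.range_orderEmbOfFin]
      rw [himage] at ht
      have : hookForm e c = ((s * t⁻¹ : ℤˣ) : ℤ) •
          hookForm e ((Finset.univ.image c).orderEmbOfFin hP.2) := by
        rw [hs, ht, smul_smul, ← Units.val_mul, inv_mul_cancel_right]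
      have hmem : hookForm e ((Finset.univ.image c).orderEmbOfFin hP.2) ∈ W :=
        Submodule.subset_span (Set.mem_range_self (f := fun P : {P : Finset (Fin n) //
          z ∉ P ∧ P.card = d} => hookForm e (P.1.orderEmbOfFin P.2.2)) ⟨_, hP⟩)
      rw [this]
      exact zsmul_mem hmem _
    · rw [hookForm_eq_zero e hc]
      exact zero_mem _
  rw [Submodule.span_le]
  rintro _ ⟨c, rfl⟩
  by_cases hc : Function.Injective c
  · by_cases hz : ∃ i, c i = z
    · obtain ⟨i, hi⟩ := hz
      have hsum := sum_hookForm_update e c i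
      rw [← Finset.add_sum_erase _ _ (Finset.mem_univ z)] at hsum
      have hcc : Function.update c i z = c := by rw [← hi, Function.update_eq_self]
      rw [hcc] at hsum
      rw [SetLike.mem_coe, eq_neg_of_add_eq_zero_left hsum]
      refine neg_mem (sum_mem fun x hx => havoid _ fun j => ?_)
      by_cases hj : j = i
      · subst hj
        simpa using hx
      · rw [Function.update_of_ne hj, ← hi]
        exact hc.ne hj
    · exact havoid c fun i hi => hz ⟨i, hi⟩
  · rw [hookForm_eq_zero e hc]
    exact zero_mem _

theorem detForm_topForm_mem (S : Fin d → Finset (Fin n)) :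
    detForm _ e (Sum.elim (fun i => topForm m (S i)) (genRow n m)) ∈
      Submodule.span ℂ (Set.range (hookForm e)) := by
  have hexp : detForm _ e (Sum.elim (fun i => topForm m (S i)) (genRow n m)) =
      ∑ c ∈ Fintype.piFinset S, hookForm e c := by
    have h := (MultilinearMap.currySum (detForm
      (MvPolynomial (Fin (m + 1) × Fin n) ℂ) e)).map_sum_finset
      (fun _ c => topForm m {c}) S
    simp only [← topForm_eq_sum] at h
    have h' := congrArg (fun F => F (genRow n m)) h
    simp only [sum_apply] at h'
    exact h'
  rw [hexp]
  exact sum_mem fun c _ => Submodule.subset_span ⟨c, rfl⟩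

end Hook

/-! ### The basis of jellyfish invariants -/

/-- Moving the first top cell to the front of the lower cells. -/
def shiftCell (d m : ℕ) : Fin d ⊕ Fin (m + 1) ≃ Fin (d + 1) ⊕ Fin m where
  toFun := Sum.elim (fun i => Sum.inl i.succ) (Fin.cons (Sum.inl 0) fun k => Sum.inr k)
  invFun := Sum.elim (Fin.cons (Sum.inr 0) fun i => Sum.inl i) fun k => Sum.inr k.succ
  left_inv r := by
    rcases r with i | k
    · rfl
    · refine Fin.cases rfl (fun k => rfl) k
  right_inv r := by
    rcases r with i | k
    · refine Fin.cases rfl (fun i => rfl) i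
    · rfl

theorem oneJellyInv_mem_span {d m : ℕ} {π : Fin (d + 1) → Finset (Fin (d + 1 + m))}
    (hπ : IsOSP (d + 1 + m) (d + 1) 1 π) :
    oneJellyInv (m + 1) (d + 1 + m) (d + 1) π ∈
      Submodule.span ℂ (Set.range (hookForm ((shiftCell d m).trans finSumFinEquiv))) := by
  set e := (shiftCell d m).trans finSumFinEquiv
  set v : Fin d ⊕ Fin (m + 1) → Fin (d + 1 + m) →
      MvPolynomial (Fin (m + 1) × Fin (d + 1 + m)) ℂ :=
    Sum.elim (fun i => topForm m (π i.succ))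
      (Fin.cons (topForm m (π 0)) fun k => genRow _ m k.succ) with hv
  have hdet : oneJellyInv (m + 1) (d + 1 + m) (d + 1) π = detForm _ e v := by
    rw [oneJellyInv_eq_detForm d.succ_pos hπ, detForm_apply, detForm_apply,
      ← Matrix.det_submatrix_equiv_self (shiftCell d m)]
    congr 1
    ext1 r r'
    rcases r with i | k
    · rfl
    · refine Fin.cases rfl (fun k => rfl) k
  have hgen : Sum.elim (fun i : Fin d => topForm m (π i.succ)) (genRow (d + 1 + m) m) =
      Function.update v (Sum.inr 0) (∑ j, topForm m (π j)) := by
    have hzero : genRow (d + 1 + m) m 0 = ∑ j, topForm m (π j) := by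
      funext c
      obtain ⟨j, hj⟩ := hπ.exists_mem c
      rw [Finset.sum_apply, Finset.sum_eq_single j, topForm, if_pos hj, genRow]
      · intro j' _ hne
        exact if_neg fun h => hne (hπ.eq_of_mem h hj)
      · simp
    rw [← hzero]
    funext r
    rcases r with i | k
    · simp [hv]
    · refine Fin.cases ?_ (fun k => ?_) k
      · simp
      · rw [Function.update_of_ne (by simp)]
        simp [hv]
  have hself : Function.update v (Sum.inr 0) (topForm m (π 0)) = v := by
    rw [Function.update_eq_self_iff]
    rfl
  have heq : detForm _ e v =
      detForm _ e (Sum.elim (fun i => topForm m (π i.succ)) (genRow (d + 1 + m) m)) := by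
    rw [hgen, MultilinearMap.map_update_sum, Fin.sum_univ_succ, hself, left_eq_add]
    refine Finset.sum_eq_zero fun i _ => ?_
    exact detForm_eq_zero e (r := Sum.inr 0) (r' := Sum.inl i) (by simp [hv]) (by simp)
  rw [hdet, heq]
  exact detForm_topForm_mem e _

theorem oneJellyInv_basis (d m : ℕ) (z : Fin (d + 1 + m))
    (π : Finset (Fin (d + 1 + m)) → Fin (d + 1) → Finset (Fin (d + 1 + m)))
    {p : Finset (Fin (d + 1 + m)) → Prop} (hp : ∀ P, p P ↔ z ∉ P ∧ P.card = d)
    (hπ : ∀ P, p P →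
      IsOSP (d + 1 + m) (d + 1) 1 (π P) ∧
        blockMinima (d + 1 + m) (d + 1) (π P) = insert z P) :
    LinearIndependent ℂ (fun P : {P // p P} =>
      oneJellyInv (m + 1) (d + 1 + m) (d + 1) (π P)) ∧
    Submodule.span ℂ (Set.range fun P : {P // p P} =>
      oneJellyInv (m + 1) (d + 1 + m) (d + 1) (π P)) =
      Submodule.span ℂ (hookSet (m + 1) (d + 1 + m) (d + 1)) := by
  obtain rfl : p = fun P => z ∉ P ∧ P.card = d := funext fun P => propext (hp P)
  have hcard : ∀ P : {P : Finset (Fin (d + 1 + m)) // z ∉ P ∧ P.card = d},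
      (insert z P.1).card = d + 1 := fun P => by
    rw [Finset.card_insert_of_notMem P.2.1, P.2.2]
  have hcompl : ∀ P : {P : Finset (Fin (d + 1 + m)) // z ∉ P ∧ P.card = d},
      (insert z P.1)ᶜ.card = m := fun P => by
    rw [Finset.card_compl, hcard P]
    simp
  have hli : LinearIndependent ℂ
      (fun P : {P : Finset (Fin (d + 1 + m)) // z ∉ P ∧ P.card = d} =>
        oneJellyInv (m + 1) (d + 1 + m) (d + 1) (π P)) := by
    refine linearIndependent_of_triangular _
      (fun P => (MvPolynomial.aeval (testPoint (insert z P.1)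
        ((insert z P.1)ᶜ.orderEmbOfFin (hcompl P)))).toLinearMap)
      (fun P => ∑ x ∈ insert z P.1, (x : ℕ)) ?_ ?_
    · intro P Q h
      rw [AlgHom.toLinearMap_apply, MvPolynomial.aeval_eq_eval] at h
      obtain ⟨hosp, hmin⟩ := hπ P P.2
      refine (eq_or_sum_lt_of_eval_ne_zero d.succ_pos hosp hmin (hcard Q) h).imp_left fun h => ?_
      exact Subtype.ext (by
        rw [← Finset.erase_insert P.2.1, h, Finset.erase_insert Q.2.1])
    · intro P
      rw [AlgHom.toLinearMap_apply, MvPolynomial.aeval_eq_eval]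
      obtain ⟨hosp, hmin⟩ := hπ P P.2
      exact eval_blockMin_ne_zero d.succ_pos hosp hmin (Finset.orderEmbOfFin _ _).injective
        fun k => Finset.mem_compl.1 (Finset.orderEmbOfFin_mem _ _ _)
  refine ⟨hli, ?_⟩
  set e := (shiftCell d m).trans finSumFinEquiv
  rw [span_hookSet e]
  have hspan := span_hookForm_le e z
  have : FiniteDimensional ℂ (Submodule.span ℂ (Set.range (hookForm e))) :=
    FiniteDimensional.span_of_finite ℂ (Set.finite_range _)
  refine Submodule.eq_of_le_of_finrank_le ?_ ?_
  · rw [Submodule.span_le]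
    rintro _ ⟨P, rfl⟩
    exact oneJellyInv_mem_span (hπ P P.2).1
  · rw [finrank_span_eq_card hli]
    have : FiniteDimensional ℂ (Submodule.span ℂ (Set.range
        fun P : {P : Finset (Fin (d + 1 + m)) // z ∉ P ∧ P.card = d} =>
          hookForm e (P.1.orderEmbOfFin P.2.2))) :=
      FiniteDimensional.span_of_finite ℂ (Set.finite_range _)
    exact (Submodule.finrank_mono hspan).trans (finrank_range_le_card _)

/-- if for each `P ⊆ {2,…,n}` with `|P| = d−1` one chooses an ordered
set partition `π P ∈ OP(n,d,1)` whose underlying unordered partition is noncrossing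
with set of block minima `{1} ∪ P`, then the resulting `1`-jellyfish invariants form a
`ℂ`-basis (a linearly independent spanning family) of the hook Specht module
`S^{(d,1^{n−d})}`, realized as the span of the products of one top-justified
`ν × ν` minor (`ν = n−d+1`) and `d−1` first-row entries. -/
theorem statement11 (n d : ℕ) (hd : 1 ≤ d) (hdn : d ≤ n)
    (π : Finset (Fin n) → (Fin d → Finset (Fin n)))
    (hπ : ∀ P : Finset (Fin n), (∀ x ∈ P, 0 < (x : ℕ)) → P.card = d - 1 →
      IsOSP n d 1 (π P) ∧
      IsNoncrossing n (Finset.univ.image (π P)) ∧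
      blockMinima n d (π P) = insert (⟨0, by omega⟩ : Fin n) P) :
    LinearIndependent ℂ
      (fun P : {P : Finset (Fin n) // (∀ x ∈ P, 0 < (x : ℕ)) ∧ P.card = d - 1} =>
        jellyInv n d 1 (π P)) ∧
    Submodule.span ℂ
      (Set.range
        (fun P : {P : Finset (Fin n) // (∀ x ∈ P, 0 < (x : ℕ)) ∧ P.card = d - 1} =>
          jellyInv n d 1 (π P))) =
      Submodule.span ℂ (flamingoSet n d 1) := by
  obtain ⟨d, rfl⟩ : ∃ d', d = d' + 1 := ⟨d - 1, by omega⟩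
  obtain ⟨m, rfl⟩ := Nat.exists_eq_add_of_le hdn
  set z : Fin (d + 1 + m) := ⟨0, by omega⟩
  have hP : ∀ P : Finset (Fin (d + 1 + m)),
      ((∀ x ∈ P, 0 < (x : ℕ)) ∧ P.card = d + 1 - 1) ↔ (z ∉ P ∧ P.card = d) := by
    intro P
    refine and_congr ⟨fun h hzP => (h z hzP).ne rfl, fun h x hx => ?_⟩ Iff.rfl
    refine Nat.pos_of_ne_zero fun hx0 => h ?_
    have : x = z := Fin.ext hx0
    exact this ▸ hx
  have key : ∀ ν, ν = m + 1 →
      LinearIndependent ℂ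
        (fun P : {P : Finset (Fin (d + 1 + m)) //
            (∀ x ∈ P, 0 < (x : ℕ)) ∧ P.card = d + 1 - 1} =>
          oneJellyInv ν (d + 1 + m) (d + 1) (π P)) ∧
      Submodule.span ℂ
        (Set.range
          (fun P : {P : Finset (Fin (d + 1 + m)) //
              (∀ x ∈ P, 0 < (x : ℕ)) ∧ P.card = d + 1 - 1} =>
            oneJellyInv ν (d + 1 + m) (d + 1) (π P))) =
        Submodule.span ℂ (hookSet ν (d + 1 + m) (d + 1)) := by
    rintro _ rfl
    exact oneJellyInv_basis d m z π hP fun P h => ⟨(hπ P h.1 h.2).1, (hπ P h.1 h.2).2.2⟩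
  exact key (d + 1 + m - (d + 1 - 1) * 1) (by omega)


end Jellyfish
end

section
/- Let γ and γ' be noncrossing set partitions of [n] = {1,…,n} all of whose blocks have size at least 2. If the set of block minima of γ equals the set of block minima of γ' and the set of block maxima of γ equals the set of block maxima of γ', then γ = γ'. (In particular, a noncrossing set partition with all blocks of size at least 2 is uniquely determined by its sets of block minima and block maxima.) -/
open scoped Classical

namespace Jellyfish

/-- Two elements are related by `P` if some block of `P` contains both. -/
def SameBlock {n : ℕ} (P : Finset (Finset (Fin n))) (a b : Fin n) : Prop :=
  ∃ B ∈ P, a ∈ B ∧ b ∈ B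

theorem SameBlock.symm {n : ℕ} {P : Finset (Finset (Fin n))} {a b : Fin n}
    (h : SameBlock P a b) : SameBlock P b a := by
  obtain ⟨B, hB, ha, hb⟩ := h
  exact ⟨B, hB, hb, ha⟩

theorem sameBlock_comm {n : ℕ} {P : Finset (Finset (Fin n))} {a b : Fin n} :
    SameBlock P a b ↔ SameBlock P b a :=
  ⟨SameBlock.symm, SameBlock.symm⟩

theorem IsUPartition.sameBlock_refl {n : ℕ} {P : Finset (Finset (Fin n))}
    (hP : IsUPartition n P) (a : Fin n) : SameBlock P a a := by
  obtain ⟨B, hB, ha⟩ := hP.2.2 a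
  exact ⟨B, hB, ha, ha⟩

theorem IsUPartition.sameBlock_iff_of_lt {n : ℕ} {P Q : Finset (Finset (Fin n))}
    (hP : IsUPartition n P) (hQ : IsUPartition n Q) {a b : Fin n}
    (hlt : a < b → (SameBlock P a b ↔ SameBlock Q a b))
    (hgt : b < a → (SameBlock P b a ↔ SameBlock Q b a)) :
    SameBlock P a b ↔ SameBlock Q a b := by
  rcases lt_trichotomy a b with h | rfl | h
  · exact hlt h
  · exact iff_of_true (hP.sameBlock_refl a) (hQ.sameBlock_refl a)
  · rw [sameBlock_comm, hgt h, sameBlock_comm]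

theorem IsUPartition.eq_of_mem {n : ℕ} {P : Finset (Finset (Fin n))} (hP : IsUPartition n P)
    {B C : Finset (Fin n)} (hB : B ∈ P) (hC : C ∈ P) {x : Fin n} (hxB : x ∈ B) (hxC : x ∈ C) :
    B = C := by
  by_contra h
  exact Finset.disjoint_left.mp (hP.2.1 B hB C hC h) hxB hxC

theorem IsUPartition.sameBlock_trans {n : ℕ} {P : Finset (Finset (Fin n))}
    (hP : IsUPartition n P) {a b c : Fin n} (hab : SameBlock P a b) (hbc : SameBlock P b c) :
    SameBlock P a c := by
  obtain ⟨B, hB, ha, hb⟩ := hab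
  obtain ⟨C, hC, hb', hc⟩ := hbc
  obtain rfl := hP.eq_of_mem hB hC hb hb'
  exact ⟨B, hB, ha, hc⟩

theorem IsUPartition.mem_blockMinimaU_iff {n : ℕ} {P : Finset (Finset (Fin n))}
    (hP : IsUPartition n P) (x : Fin n) :
    x ∈ blockMinimaU n P ↔ ∀ w < x, ¬ SameBlock P w x := by
  simp only [blockMinimaU, Finset.mem_filter, Finset.mem_univ, true_and]
  constructor
  · rintro ⟨B, hB, hx, hmin⟩ w hw ⟨C, hC, hwC, hxC⟩
    obtain rfl := hP.eq_of_mem hB hC hx hxC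
    exact absurd (hmin w hwC) (not_le.mpr hw)
  · intro h
    obtain ⟨B, hB, hx⟩ := hP.2.2 x
    exact ⟨B, hB, hx, fun y hy => not_lt.mp fun hlt => h y hlt ⟨B, hB, hy, hx⟩⟩

theorem IsUPartition.mem_blockMaximaU_iff {n : ℕ} {P : Finset (Finset (Fin n))}
    (hP : IsUPartition n P) (x : Fin n) :
    x ∈ blockMaximaU n P ↔ ∀ w > x, ¬ SameBlock P w x := by
  simp only [blockMaximaU, Finset.mem_filter, Finset.mem_univ, true_and]
  constructor
  · rintro ⟨B, hB, hx, hmax⟩ w hw ⟨C, hC, hwC, hxC⟩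
    obtain rfl := hP.eq_of_mem hB hC hx hxC
    exact absurd (hmax w hwC) (not_le.mpr hw)
  · intro h
    obtain ⟨B, hB, hx⟩ := hP.2.2 x
    exact ⟨B, hB, hx, fun y hy => not_lt.mp fun hlt => h y hlt ⟨B, hB, hy, hx⟩⟩

/-- The elements below `x` whose block has no maximum below `x`. -/
noncomputable def openBefore {n : ℕ} (P : Finset (Finset (Fin n))) (x : Fin n) :
    Finset (Fin n) :=
  Finset.univ.filter fun y => y < x ∧ ∀ z < x, SameBlock P y z → z ∉ blockMaximaU n P

theorem mem_openBefore {n : ℕ} {P : Finset (Finset (Fin n))} {x y : Fin n} :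
    y ∈ openBefore P x ↔ y < x ∧ ∀ z < x, SameBlock P y z → z ∉ blockMaximaU n P := by
  simp [openBefore]

theorem IsUPartition.mem_openBefore_of_sameBlock {n : ℕ} {P : Finset (Finset (Fin n))}
    (hP : IsUPartition n P) {w x : Fin n} (hwx : w < x) (h : SameBlock P w x) :
    w ∈ openBefore P x :=
  mem_openBefore.mpr ⟨hwx, fun z hz hwz hmax =>
    (hP.mem_blockMaximaU_iff z).mp hmax x hz (hP.sameBlock_trans h.symm hwz)⟩

theorem IsUPartition.exists_sameBlock_ge_of_mem_openBefore {n : ℕ}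
    {P : Finset (Finset (Fin n))} (hP : IsUPartition n P) {x y : Fin n}
    (hy : y ∈ openBefore P x) : ∃ e, x ≤ e ∧ SameBlock P y e := by
  obtain ⟨B, hB, hyB⟩ := hP.2.2 y
  refine ⟨B.max' ⟨y, hyB⟩, not_lt.mp fun hlt => ?_, B, hB, hyB, B.max'_mem _⟩
  refine (mem_openBefore.mp hy).2 _ hlt ⟨B, hB, hyB, B.max'_mem _⟩ ?_
  simp only [blockMaximaU, Finset.mem_filter, Finset.mem_univ, true_and]
  exact ⟨B, hB, B.max'_mem _, fun z hz => B.le_max' z hz⟩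

/-- In a noncrossing partition, an element that is not a block minimum lies in the block of
the largest open element before it. -/
theorem IsNoncrossing.sameBlock_of_isGreatest {n : ℕ} {P : Finset (Finset (Fin n))}
    (hnc : IsNoncrossing n P) (hP : IsUPartition n P) {w x y : Fin n}
    (hwx : w < x) (hw : SameBlock P w x) (hy : IsGreatest (openBefore P x : Set (Fin n)) y) :
    SameBlock P y x := by
  have hwy : w ≤ y := hy.2 (hP.mem_openBefore_of_sameBlock hwx hw)
  have hyx : y < x := (mem_openBefore.mp hy.1).1
  obtain ⟨e, hxe, hye⟩ := hP.exists_sameBlock_ge_of_mem_openBefore hy.1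
  rcases hwy.eq_or_lt with rfl | hwy
  · exact hw
  rcases hxe.eq_or_lt with rfl | hxe
  · exact hye
  obtain ⟨B, hB, hwB, hxB⟩ := hw
  obtain ⟨C, hC, hyC, heC⟩ := hye
  obtain rfl := hnc w y x e hwy hyx hxe B hB C hC hwB hxB hyC heC
  exact ⟨B, hB, hyC, hxB⟩

theorem sameBlock_iff_of_blockMinimaU_eq_of_blockMaximaU_eq {n : ℕ}
    {P Q : Finset (Finset (Fin n))} (hP : IsUPartition n P) (hQ : IsUPartition n Q)
    (hncP : IsNoncrossing n P) (hncQ : IsNoncrossing n Q)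
    (hmin : blockMinimaU n P = blockMinimaU n Q) (hmax : blockMaximaU n P = blockMaximaU n Q)
    (a b : Fin n) : SameBlock P a b ↔ SameBlock Q a b := by
  suffices below : ∀ x w : Fin n, w < x → (SameBlock P w x ↔ SameBlock Q w x) by
    exact hP.sameBlock_iff_of_lt hQ (below b a) (below a b)
  intro x
  induction x using WellFoundedLT.induction with
  | ind x ih =>
    have agree : ∀ u v : Fin n, u < x → v < x → (SameBlock P u v ↔ SameBlock Q u v) :=
      fun u v hu hv => hP.sameBlock_iff_of_lt hQ (ih v hv u) (ih u hu v)
    have hopen : openBefore P x = openBefore Q x := by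
      ext y
      rw [mem_openBefore, mem_openBefore, hmax]
      exact and_congr_right fun hy => forall₂_congr fun z hz => by rw [agree y z hy hz]
    by_cases hx : x ∈ blockMinimaU n P
    · intro w hw
      exact iff_of_false ((hP.mem_blockMinimaU_iff x).mp hx w hw)
        ((hQ.mem_blockMinimaU_iff x).mp (hmin ▸ hx) w hw)
    · have hxQ : x ∉ blockMinimaU n Q := hmin ▸ hx
      rw [hP.mem_blockMinimaU_iff] at hx
      rw [hQ.mem_blockMinimaU_iff] at hxQ
      push Not at hx hxQ
      obtain ⟨u, hux, hu⟩ := hx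
      obtain ⟨v, hvx, hv⟩ := hxQ
      obtain ⟨y, hgreatest⟩ : ∃ y, IsGreatest (openBefore P x : Set (Fin n)) y :=
        ⟨_, (openBefore P x).isGreatest_max' ⟨u, hP.mem_openBefore_of_sameBlock hux hu⟩⟩
      have hyx : y < x := (mem_openBefore.mp hgreatest.1).1
      have hyP := hncP.sameBlock_of_isGreatest hP hux hu hgreatest
      have hyQ := hncQ.sameBlock_of_isGreatest hQ hvx hv (hopen ▸ hgreatest)
      intro w hw
      exact ⟨fun h => hQ.sameBlock_trans
          ((agree w y hw hyx).mp (hP.sameBlock_trans h hyP.symm)) hyQ,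
        fun h => hP.sameBlock_trans
          ((agree w y hw hyx).mpr (hQ.sameBlock_trans h hyQ.symm)) hyP⟩

theorem IsUPartition.subset_of_sameBlock_iff {n : ℕ} {P Q : Finset (Finset (Fin n))}
    (hP : IsUPartition n P) (hQ : IsUPartition n Q)
    (h : ∀ a b, SameBlock P a b ↔ SameBlock Q a b) : P ⊆ Q := by
  intro B hB
  obtain ⟨x, hx⟩ := hP.1 B hB
  obtain ⟨C, hC, hxC⟩ := hQ.2.2 x
  suffices B = C from this ▸ hC
  ext y
  constructor
  · intro hy
    obtain ⟨D, hD, hxD, hyD⟩ := (h x y).mp ⟨B, hB, hx, hy⟩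
    exact hQ.eq_of_mem hD hC hxD hxC ▸ hyD
  · intro hy
    obtain ⟨D, hD, hxD, hyD⟩ := (h x y).mpr ⟨C, hC, hxC, hy⟩
    exact hP.eq_of_mem hD hB hxD hx ▸ hyD

/-- a noncrossing set partition of `[n]` with all blocks of size at
least `2` is uniquely determined by its set of block minima together with its set of
block maxima. -/
theorem statement12 (n : ℕ) (γ γ' : Finset (Finset (Fin n)))
    (hγ : IsUPartition n γ) (hγ' : IsUPartition n γ')
    (hnc : IsNoncrossing n γ) (hnc' : IsNoncrossing n γ')
    (h2 : ∀ B ∈ γ, 2 ≤ B.card) (h2' : ∀ B ∈ γ', 2 ≤ B.card)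
    (hmin : blockMinimaU n γ = blockMinimaU n γ')
    (hmax : blockMaximaU n γ = blockMaximaU n γ') :
    γ = γ' := by
  have h := sameBlock_iff_of_blockMinimaU_eq_of_blockMaximaU_eq hγ hγ' hnc hnc' hmin hmax
  exact (hγ.subset_of_sameBlock_iff hγ' h).antisymm
    (hγ'.subset_of_sameBlock_iff hγ fun a b => (h a b).symm)

end Jellyfish
end
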